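/- Let n be a positive integer with n ≡ 3 (mod 4). Then there is no n × n real symmetric matrix S with zero diagonal and all off-diagonal entries equal to ±1 (a Seidel matrix) whose spectrum is symmetric, i.e., such that for every real λ the multiplicity of λ as an eigenvalue of S equals the multiplicity of -λ. -/

import Mathlib

open Matrix

/-- The multiplicity of `μ` as an eigenvalue of the matrix `S`:
the dimension of the kernel of `S - μ • 1`. -/
noncomputable def eigMult {n : ℕ} (S : Matrix (Fin n) (Fin n) ℝ) (μ : ℝ) : ℕ :=
  Module.finrank ℝ (LinearMap.ker (Matrix.toLin' (S - μ • (1 : Matrix (Fin n) (Fin n) ℝ))))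

lemma eigMult_eq {n : ℕ} (S : Matrix (Fin n) (Fin n) ℝ) (μ : ℝ) :
    Module.finrank ℝ (Module.End.eigenspace (toEuclideanLin S) μ) = eigMult S μ := by
  unfold eigMult
  refine LinearEquiv.finrank_eq ((WithLp.linearEquiv 2 ℝ (Fin n → ℝ)).ofSubmodules _ _ ?_)
  ext x
  rw [Submodule.mem_map_equiv, Module.End.mem_eigenspace_iff, LinearMap.mem_ker,
    Matrix.toLin'_apply, Matrix.sub_mulVec, sub_eq_zero, Matrix.smul_mulVec, Matrix.one_mulVec]
  constructor
  · intro h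
    exact congrArg (WithLp.ofLp) h
  · intro h
    exact congrArg (WithLp.toLp 2) h

lemma sing_of_symm {n : ℕ} (hn : n % 2 = 1) (S : Matrix (Fin n) (Fin n) ℝ) (hS : S.IsSymm)
    (h : ∀ μ : ℝ, eigMult S μ = eigMult S (-μ)) : S.det = 0 := by
  have hT : (toEuclideanLin S).IsSymmetric :=
    isSymmetric_toEuclideanLin_iff.mpr (by
      rw [Matrix.IsHermitian, conjTranspose_eq_transpose_of_trivial]; exact hS)
  have hf : Module.finrank ℝ (EuclideanSpace ℝ (Fin n)) = n := by simp
  have hc : ∀ μ : ℝ, Finset.card {i | hT.eigenvalues hf i = μ} = eigMult S μ := by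
    intro μ
    rw [← eigMult_eq]
    exact hT.card_filter_eigenvalues_eq hf μ
  set e := hT.eigenvalues hf with he
  have h0 : eigMult S 0 ≠ 0 := by
    intro h0
    have hsum := Finset.card_eq_sum_card_image e Finset.univ
    have hz : (∑ b ∈ Finset.univ.image e, ((eigMult S b : ℕ) : ZMod 2)) = 0 := by
      refine Finset.sum_involution (fun a _ => -a) ?_ ?_ ?_ ?_
      · intro a _
        rw [← h a]
        exact CharTwo.add_self_eq_zero _
      · intro a _ ha hh
        have : a = 0 := by linarith
        subst this
        simp [h0] at ha
      · intro a ha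
        obtain ⟨i, _, rfl⟩ := Finset.mem_image.mp ha
        have : Finset.card {j | e j = - e i} ≠ 0 := by
          rw [hc, ← h, ← hc]
          exact Finset.card_ne_zero_of_mem (a := i) (by simp)
        obtain ⟨j, hj⟩ := Finset.card_ne_zero.mp this
        simp only [Finset.mem_filter, Finset.mem_univ, true_and] at hj
        exact Finset.mem_image.mpr ⟨j, Finset.mem_univ _, hj⟩
      · intro a _
        simp
    simp only [hc] at hsum
    rw [← Nat.cast_sum, ← hsum, ZMod.natCast_eq_zero_iff] at hz
    simp at hz
    omega
  rw [← Matrix.exists_mulVec_eq_zero_iff]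
  by_contra hne
  push Not at hne
  apply h0
  unfold eigMult
  rw [Submodule.finrank_eq_zero, LinearMap.ker_eq_bot']
  intro v hv
  by_contra hv0
  exact hne v hv0 (by simpa using hv)

lemma sum_mod_four {ι : Type*} [DecidableEq ι] (T : ι → ι → ℤ) (hs : ∀ i j, T i j = T j i)
    (hd : ∀ i, T i i = 0) (ho : ∀ i j, i ≠ j → T i j % 2 = 1) (s : Finset ι) :
    ∃ k : ℤ, ∑ i ∈ s, ∑ j ∈ s, T i j = s.card * (s.card - 1) + 4 * k := by
  induction s using Finset.induction_on with
  | empty => exact ⟨0, by simp⟩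
  | insert a s ha ih =>
    obtain ⟨k, hk⟩ := ih
    have h1 : ∃ m : ℤ, ∑ j ∈ s, T a j = s.card + 2 * m := by
      refine ⟨∑ j ∈ s, T a j / 2, ?_⟩
      rw [Finset.mul_sum, Finset.card_eq_sum_ones, Nat.cast_sum, ← Finset.sum_add_distrib]
      refine Finset.sum_congr rfl fun j hj => ?_
      have := ho a j (by rintro rfl; exact ha hj)
      push_cast
      omega
    obtain ⟨m, hm⟩ := h1
    have h2 : ∑ i ∈ s, T i a = s.card + 2 * m := by
      rw [← hm]; exact Finset.sum_congr rfl fun j _ => hs _ _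
    refine ⟨k + m, ?_⟩
    rw [Finset.card_insert_of_notMem ha]
    simp only [Finset.sum_insert ha, Finset.sum_add_distrib, hd, hm, h2, hk]
    push_cast
    ring

lemma int_nonsing {n : ℕ} (hn : n % 4 = 3) (S : Matrix (Fin n) (Fin n) ℤ)
    (hs : ∀ i j, S i j = S j i) (hd : ∀ i, S i i = 0)
    (ho : ∀ i j, i ≠ j → S i j % 2 = 1) : S.det ≠ 0 := by
  intro hdet
  obtain ⟨w, hw0, hw⟩ := Matrix.exists_mulVec_eq_zero_iff.mpr hdet
  obtain ⟨v, hv, hg⟩ := Finset.extract_gcd w (s := Finset.univ) ⟨⟨0, by omega⟩, Finset.mem_univ _⟩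
  set g := Finset.univ.gcd w
  have hg0 : g ≠ 0 := by
    intro h
    apply hw0
    ext i
    rw [hv i (Finset.mem_univ _), h]; simp
  have hSv : ∀ i, ∑ j, S i j * v j = 0 := by
    intro i
    have h1 := congrFun hw i
    simp only [Matrix.mulVec, dotProduct, Pi.zero_apply] at h1
    have h2 : g * ∑ j, S i j * v j = 0 := by
      rw [← h1, Finset.mul_sum]
      refine Finset.sum_congr rfl fun j _ => ?_
      rw [hv j (Finset.mem_univ _)]; ring
    exact (mul_eq_zero.mp h2).resolve_left hg0
  have hpar : ∀ i, (2 : ℤ) ∣ (∑ j, v j) - v i := by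
    intro i
    have : (∑ j, v j) - v i = ∑ j, (v j - (if j = i then v j else 0) - S i j * v j) := by
      simp [Finset.sum_sub_distrib, hSv]
    rw [this]
    refine Finset.dvd_sum fun j _ => ?_
    by_cases hj : j = i
    · subst hj; simp [hd]
    · have := ho i j (Ne.symm hj)
      rw [if_neg hj, show v j - 0 - S i j * v j = (1 - S i j) * v j by ring]
      exact Dvd.dvd.mul_right (by omega) _
  have hodd : ∀ i, v i % 2 = 1 := by
    by_contra hc
    push Not at hc
    obtain ⟨i, hi⟩ := hc
    have h2 : (2 : ℤ) ∣ Finset.univ.gcd v := by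
      refine Finset.dvd_gcd fun j _ => ?_
      have := hpar i
      have := hpar j
      omega
    rw [hg] at h2
    omega
  obtain ⟨k, hk⟩ := sum_mod_four (fun i j => S i j * v i * v j)
    (fun i j => by rw [hs i j]; ring) (fun i => by simp [hd])
    (fun i j hij => by
      have a := Int.odd_iff.mpr (ho i j hij)
      have b := Int.odd_iff.mpr (hodd i)
      have c := Int.odd_iff.mpr (hodd j)
      exact Int.odd_iff.mp ((a.mul b).mul c)) Finset.univ
  have hz : ∑ i, ∑ j, S i j * v i * v j = 0 := by
    refine Finset.sum_eq_zero fun i _ => ?_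
    have : ∑ j, S i j * v i * v j = v i * ∑ j, S i j * v j := by
      rw [Finset.mul_sum]; exact Finset.sum_congr rfl fun j _ => by ring
    rw [this, hSv, mul_zero]
  rw [hz, Finset.card_univ, Fintype.card_fin] at hk
  obtain ⟨q, rfl⟩ : ∃ q, n = 4 * q + 3 := ⟨n / 4, by omega⟩
  push_cast at hk
  have : (0 : ℤ) = 4 * (4 * (q : ℤ) * q + 5 * q + 1 + k) + 2 := by linarith
  omega

/-- For `n ≡ 3 (mod 4)`, no Seidel matrix of order `n` (real symmetric, zero diagonal,
off-diagonal entries `±1`) has a symmetric spectrum. -/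
theorem no_seidel_matrix_symmetric_spectrum_of_three_mod_four
    (n : ℕ) (hpos : 0 < n) (hn : n % 4 = 3) :
    ¬ ∃ S : Matrix (Fin n) (Fin n) ℝ,
        S.IsSymm ∧
        (∀ i, S i i = 0) ∧
        (∀ i j, i ≠ j → S i j = 1 ∨ S i j = -1) ∧
        (∀ μ : ℝ, eigMult S μ = eigMult S (-μ)) := by
  rintro ⟨S, hS, hd, ho, h⟩
  have hdet := sing_of_symm (by omega) S hS h
  let A : Matrix (Fin n) (Fin n) ℤ := Matrix.of fun i j => ⌊S i j⌋
  have hA : A.map (Int.castRingHom ℝ) = S := by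
    ext i j
    by_cases hij : i = j
    · subst hij; simp [A, hd]
    · rcases ho i j hij with h1 | h1
      · simp [A, h1]
      · simp only [A, Matrix.map_apply, Matrix.of_apply, h1]
        rw [show (-1 : ℝ) = ((-1 : ℤ) : ℝ) by simp, Int.floor_intCast]
        simp
  refine int_nonsing hn A ?_ ?_ ?_ ?_
  · intro i j
    simp only [A, Matrix.of_apply]
    rw [hS.apply]
  · intro i
    simp [A, hd]
  · intro i j hij
    simp only [A, Matrix.of_apply]
    rcases ho i j hij with h1 | h1
    · simp [h1]
    · rw [h1, show (-1 : ℝ) = ((-1 : ℤ) : ℝ) by simp, Int.floor_intCast]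
      rfl
  · have h1 : ((A.det : ℤ) : ℝ) = 0 := by
      rw [← hdet, ← hA]
      exact RingHom.map_det (Int.castRingHom ℝ) A
    exact_mod_cast h1
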